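/- For the curvature Lagrangian L(x₀,x₁,x₂) = α√δ₂/δ₁ and every smooth function ε : ℝ → ℝ, the transformation δx = 2ε(t) p̂⁰ + ε′(t) p̂¹ is a Noether gauge transformation with conserved quantity G_L = ε(t)(p̂⁰ p̂⁰): the identity ⟨[L], 2ε(t) p̂⁰ + ε′(t) p̂¹⟩ + D_t( ε(t)(p̂⁰ p̂⁰) ) = 0 holds identically for all (t,x₀,x₁,x₂,x₃,x₄) with δ₁ > 0 and δ₂ > 0. -/

import Mathlib

open scoped BigOperators Matrix

noncomputable section

/-- `V d` is `ℝ^d`. -/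
abbrev V (d : ℕ) := Fin d → ℝ

variable {d : ℕ}

/-- The bilinear form determined by the symmetric matrix `B`:
`(u v) = B(u,v) = uᵀ B v`. -/
def bf (B : Matrix (Fin d) (Fin d) ℝ) (u v : V d) : ℝ := u ⬝ᵥ B *ᵥ v

/-- The Gram determinant of a family of vectors with respect to `B`. -/
def gram (B : Matrix (Fin d) (Fin d) ℝ) {m : ℕ} (x : Fin m → V d) : ℝ :=
  (Matrix.of fun i j => bf B (x i) (x j)).det

/-- `δ₁ = (x₁ x₁)` as a `1×1` Gram determinant. -/
def d1 (B : Matrix (Fin d) (Fin d) ℝ) (x1 : V d) : ℝ := gram B ![x1]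

/-- `δ₂`, the Gram determinant of `x₁, x₂`. -/
def d2 (B : Matrix (Fin d) (Fin d) ℝ) (x1 x2 : V d) : ℝ := gram B ![x1, x2]

/-- `δ₃`, the Gram determinant of `x₁, x₂, x₃`. -/
def d3 (B : Matrix (Fin d) (Fin d) ℝ) (x1 x2 x3 : V d) : ℝ := gram B ![x1, x2, x3]

/-- The orthogonalized vector `ξ₂ = x₂ − ((x₂ ξ₁)/(ξ₁ ξ₁)) ξ₁` (with `ξ₁ = x₁`). -/
def xi2 (B : Matrix (Fin d) (Fin d) ℝ) (x1 x2 : V d) : V d :=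
  x2 - (bf B x2 x1 / bf B x1 x1) • x1

/-- The orthogonalized vector
`ξ₃ = x₃ − ((x₃ ξ₂)/(ξ₂ ξ₂)) ξ₂ − ((x₃ ξ₁)/(ξ₁ ξ₁)) ξ₁`. -/
def xi3 (B : Matrix (Fin d) (Fin d) ℝ) (x1 x2 x3 : V d) : V d :=
  x3 - (bf B x3 (xi2 B x1 x2) / bf B (xi2 B x1 x2) (xi2 B x1 x2)) • xi2 B x1 x2
     - (bf B x3 x1 / bf B x1 x1) • x1

/-- The curvature Lagrangian `L(x₀,x₁,x₂) = α √δ₂ / δ₁` of the relativistic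
particle (independent of `x₀`). -/
def Lc (B : Matrix (Fin d) (Fin d) ℝ) (α : ℝ) (x : V d × V d × V d) : ℝ :=
  α * Real.sqrt (d2 B x.2.1 x.2.2) / d1 B x.2.1

/-- The Ostrogradskii momentum `p̂¹`, identified with a vector via `B`:
the (for nondegenerate symmetric `B`, unique) vector with
`B(p̂¹,v) = (∂L/∂x₂)[v]` for all `v`. -/
def p1h (B : Matrix (Fin d) (Fin d) ℝ) (α : ℝ) (x0 x1 x2 : V d) : V d :=
  B⁻¹ *ᵥ fun a => fderiv ℝ (Lc B α) (x0, x1, x2) (0, 0, Pi.single a 1)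

/-- The Ostrogradskii momentum `p̂⁰`, identified with a vector via `B`:
the vector with `B(p̂⁰,v) = (∂L/∂x₁)[v] − (D_t B(p̂¹,·))[v]` for all `v`. -/
def p0h (B : Matrix (Fin d) (Fin d) ℝ) (α : ℝ) (x0 x1 x2 x3 : V d) : V d :=
  B⁻¹ *ᵥ fun a =>
    fderiv ℝ (Lc B α) (x0, x1, x2) (0, Pi.single a 1, 0) -
      fderiv ℝ (fun y : V d × V d × V d =>
          bf B (p1h B α y.1 y.2.1 y.2.2) (Pi.single a 1))
        (x0, x1, x2) (x1, x2, x3)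

/-- The Euler–Lagrange expression `[L] = ∂L/∂x₀ − D_t(B(p̂⁰,·))` as a covector,
evaluated on the vector `v`. -/
def ELc (B : Matrix (Fin d) (Fin d) ℝ) (α : ℝ) (x0 x1 x2 x3 x4 : V d) (v : V d) : ℝ :=
  fderiv ℝ (Lc B α) (x0, x1, x2) (v, 0, 0) -
    fderiv ℝ (fun y : V d × V d × V d × V d =>
        bf B (p0h B α y.1 y.2.1 y.2.2.1 y.2.2.2) v)
      (x0, x1, x2, x3) (x1, x2, x3, x4)

/-- The formal total time derivative of a time-dependent function
`f(t,x₀,x₁,x₂,x₃)`, a function of `(t,x₀,…,x₄)`. -/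
def DtT (f : ℝ × (V d × V d × V d × V d) → ℝ)
    (t : ℝ) (x0 x1 x2 x3 x4 : V d) : ℝ :=
  fderiv ℝ f (t, (x0, x1, x2, x3)) (1, (x1, x2, x3, x4))

theorem bf_add_left (B : Matrix (Fin d) (Fin d) ℝ) (u v w : V d) :
    bf B (u + v) w = bf B u w + bf B v w := by
  simp [bf, add_dotProduct]

theorem bf_add_right (B : Matrix (Fin d) (Fin d) ℝ) (u v w : V d) :
    bf B u (v + w) = bf B u v + bf B u w := by
  simp [bf, Matrix.mulVec_add, dotProduct_add]

theorem bf_smul_left (B : Matrix (Fin d) (Fin d) ℝ) (c : ℝ) (u v : V d) :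
    bf B (c • u) v = c * bf B u v := by
  simp [bf, smul_dotProduct]

theorem bf_smul_right (B : Matrix (Fin d) (Fin d) ℝ) (c : ℝ) (u v : V d) :
    bf B u (c • v) = c * bf B u v := by
  simp [bf, Matrix.mulVec_smul, dotProduct_smul]

theorem bf_sub_left (B : Matrix (Fin d) (Fin d) ℝ) (u v w : V d) :
    bf B (u - v) w = bf B u w - bf B v w := by
  simp [bf, sub_dotProduct]

theorem bf_comm {B : Matrix (Fin d) (Fin d) ℝ} (hB : B.IsSymm) (u v : V d) :
    bf B u v = bf B v u := by
  unfold bf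
  rw [Matrix.dotProduct_mulVec, dotProduct_comm, ← Matrix.mulVec_transpose, hB.eq]

/-- Raising the index of the covector `B(u,·)` recovers `u`. -/
theorem inv_mulVec_bf_single {B : Matrix (Fin d) (Fin d) ℝ} (hB : B.IsSymm)
    (hBnd : IsUnit B.det) (u : V d) :
    (B⁻¹ *ᵥ fun a => bf B u (Pi.single a 1)) = u := by
  have h : (fun a => bf B u (Pi.single a 1)) = B *ᵥ u := by
    ext a
    rw [bf_comm hB, bf, single_one_dotProduct]
  rw [h, Matrix.mulVec_mulVec, Matrix.nonsing_inv_mul B hBnd, Matrix.one_mulVec]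

theorem d1_eq_bf (B : Matrix (Fin d) (Fin d) ℝ) (x1 : V d) : d1 B x1 = bf B x1 x1 := by
  simp [d1, gram]

theorem d2_eq_bf {B : Matrix (Fin d) (Fin d) ℝ} (hB : B.IsSymm) (x1 x2 : V d) :
    d2 B x1 x2 = bf B x1 x1 * bf B x2 x2 - bf B x1 x2 ^ 2 := by
  simp [d2, gram, Matrix.det_fin_two, bf_comm hB x2 x1, sq]

section Calculus

variable {E : Type*} [NormedAddCommGroup E] [NormedSpace ℝ E]

theorem ContDiffAt.bf (B : Matrix (Fin d) (Fin d) ℝ) {n : WithTop ℕ∞} {u v : E → V d} {x : E}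
    (hu : ContDiffAt ℝ n u x) (hv : ContDiffAt ℝ n v x) :
    ContDiffAt ℝ n (fun y => _root_.bf B (u y) (v y)) x := by
  simp only [_root_.bf, dotProduct, Matrix.mulVec]
  rw [contDiffAt_pi] at hu hv
  exact ContDiffAt.sum fun i _ => (hu i).mul
    (ContDiffAt.sum fun j _ => contDiffAt_const.mul (hv j))

theorem HasDerivAt.bf (B : Matrix (Fin d) (Fin d) ℝ) {u v : ℝ → V d} {u' v' : V d} {t : ℝ}
    (hu : HasDerivAt u u' t) (hv : HasDerivAt v v' t) :
    HasDerivAt (fun s => _root_.bf B (u s) (v s))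
      (_root_.bf B u' (v t) + _root_.bf B (u t) v') t := by
  simp only [_root_.bf, dotProduct, Matrix.mulVec]
  rw [hasDerivAt_pi] at hu hv
  rw [← Finset.sum_add_distrib]
  exact HasDerivAt.fun_sum fun i _ => (hu i).mul
    (HasDerivAt.fun_sum fun j _ => (hv j).const_mul (B i j))

theorem fderiv_apply_eq_of_hasDerivAt_line {F : Type*} [NormedAddCommGroup F] [NormedSpace ℝ F]
    {f : E → F} {x v : E} {f' : F} (hf : DifferentiableAt ℝ f x)
    (h : HasDerivAt (fun t : ℝ => f (x + t • v)) f' 0) : fderiv ℝ f x v = f' :=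
  (hf.hasFDerivAt.hasLineDerivAt v).unique h

theorem DifferentiableAt.hasDerivAt_line {F : Type*} [NormedAddCommGroup F] [NormedSpace ℝ F]
    {f : E → F} {x : E} (hf : DifferentiableAt ℝ f x) (v : E) :
    HasDerivAt (fun t : ℝ => f (x + t • v)) (fderiv ℝ f x v) 0 :=
  hf.hasFDerivAt.hasLineDerivAt v

theorem hasDerivAt_add_smul (x v : E) : HasDerivAt (fun t : ℝ => x + t • v) v 0 := by
  simpa using ((hasDerivAt_id (0 : ℝ)).smul_const v).const_add x

theorem differentiableAt_bf (B : Matrix (Fin d) (Fin d) ℝ) {f g : E → V d} {x : E}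
    (hf : DifferentiableAt ℝ f x) (hg : DifferentiableAt ℝ g x) :
    DifferentiableAt ℝ (fun y => bf B (f y) (g y)) x := by
  simp only [bf, dotProduct, Matrix.mulVec]
  rw [differentiableAt_pi] at hf hg
  exact DifferentiableAt.fun_sum fun i _ => (hf i).mul
    (DifferentiableAt.fun_sum fun j _ => (hg j).const_mul (B i j))

/-- Product rule for `B(f,g)` along a direction. -/
theorem fderiv_bf_apply (B : Matrix (Fin d) (Fin d) ℝ) {f g : E → V d} {x : E}
    (hf : DifferentiableAt ℝ f x) (hg : DifferentiableAt ℝ g x) (v : E) :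
    fderiv ℝ (fun y => bf B (f y) (g y)) x v =
      bf B (fderiv ℝ f x v) (g x) + bf B (f x) (fderiv ℝ g x v) := by
  apply fderiv_apply_eq_of_hasDerivAt_line (differentiableAt_bf B hf hg)
  simpa using (hf.hasDerivAt_line v).bf B (hg.hasDerivAt_line v)

end Calculus

/-- Closed form of the momentum `p̂¹ = α ξ₂ / √δ₂`. -/
def momentumOne (B : Matrix (Fin d) (Fin d) ℝ) (α : ℝ) (x1 x2 : V d) : V d :=
  (α / √(d2 B x1 x2)) • (x2 - (bf B x1 x2 / bf B x1 x1) • x1)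

/-- Closed form of `∂L/∂x₁`, identified with a vector. -/
def gradOne (B : Matrix (Fin d) (Fin d) ℝ) (α : ℝ) (x1 x2 : V d) : V d :=
  (α * (bf B x2 x2 / (√(d2 B x1 x2) * bf B x1 x1) -
      2 * √(d2 B x1 x2) / bf B x1 x1 ^ 2)) • x1 +
    (-(α * bf B x1 x2 / (√(d2 B x1 x2) * bf B x1 x1))) • x2

/-- Closed form of the total derivative of `p̂¹`. -/
def momentumOneDot (B : Matrix (Fin d) (Fin d) ℝ) (α : ℝ) (x1 x2 x3 : V d) : V d :=
  (-(α * (bf B x1 x1 * bf B x2 x3 - bf B x1 x2 * bf B x1 x3) /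
      (d2 B x1 x2 * √(d2 B x1 x2)))) • (x2 - (bf B x1 x2 / bf B x1 x1) • x1) +
    (α / √(d2 B x1 x2)) • (x3 - ((bf B x1 x2 / bf B x1 x1) • x2 +
      (((bf B x2 x2 + bf B x1 x3) * bf B x1 x1 - 2 * bf B x1 x2 ^ 2) / bf B x1 x1 ^ 2) • x1))

section Momenta

variable {B : Matrix (Fin d) (Fin d) ℝ} {α : ℝ} {x0 x1 x2 x3 : V d}

section Smooth

variable {E : Type*} [NormedAddCommGroup E] [NormedSpace ℝ E] {u v w : E → V d} {x : E}
  {n : WithTop ℕ∞}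

theorem contDiffAt_d2 (hB : B.IsSymm) (hu : ContDiffAt ℝ n u x) (hv : ContDiffAt ℝ n v x) :
    ContDiffAt ℝ n (fun y => d2 B (u y) (v y)) x := by
  simp only [d2_eq_bf hB]
  exact ((hu.bf B hu).mul (hv.bf B hv)).sub ((hu.bf B hv).pow 2)

theorem contDiffAt_Lc (hB : B.IsSymm) (h1 : 0 < d1 B x1) (h2 : 0 < d2 B x1 x2) :
    ContDiffAt ℝ n (Lc B α) (x0, x1, x2) := by
  unfold Lc
  have hu : ContDiffAt ℝ n (fun y : V d × V d × V d => y.2.1) (x0, x1, x2) := by fun_prop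
  have hv : ContDiffAt ℝ n (fun y : V d × V d × V d => y.2.2) (x0, x1, x2) := by fun_prop
  simp only [d1_eq_bf] at h1 ⊢
  exact (contDiffAt_const.mul ((contDiffAt_d2 hB hu hv).sqrt h2.ne')).div (hu.bf B hu) h1.ne'

theorem contDiffAt_momentumOne (hB : B.IsSymm) (hu : ContDiffAt ℝ n u x)
    (hv : ContDiffAt ℝ n v x) (h1 : 0 < d1 B (u x)) (h2 : 0 < d2 B (u x) (v x)) :
    ContDiffAt ℝ n (fun y => momentumOne B α (u y) (v y)) x := by
  unfold momentumOne
  rw [d1_eq_bf] at h1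
  exact (contDiffAt_const.div ((contDiffAt_d2 hB hu hv).sqrt h2.ne')
    (Real.sqrt_pos.2 h2).ne').smul (hv.sub (((hu.bf B hv).div (hu.bf B hu) h1.ne').smul hu))

theorem contDiffAt_gradOne (hB : B.IsSymm) (hu : ContDiffAt ℝ n u x)
    (hv : ContDiffAt ℝ n v x) (h1 : 0 < d1 B (u x)) (h2 : 0 < d2 B (u x) (v x)) :
    ContDiffAt ℝ n (fun y => gradOne B α (u y) (v y)) x := by
  unfold gradOne
  rw [d1_eq_bf] at h1
  have hR := (Real.sqrt_pos.2 h2).ne'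
  have hs := (contDiffAt_d2 hB hu hv).sqrt h2.ne'
  have ha := hu.bf B hu
  exact ((contDiffAt_const.mul (((hv.bf B hv).div (hs.mul ha) (mul_ne_zero hR h1.ne')).sub
    ((contDiffAt_const.mul hs).div (ha.pow 2) (pow_ne_zero 2 h1.ne')))).smul hu).add
    (((contDiffAt_const.mul (hu.bf B hv)).div (hs.mul ha) (mul_ne_zero hR h1.ne')).neg.smul hv)

theorem contDiffAt_momentumOneDot (hB : B.IsSymm) (hu : ContDiffAt ℝ n u x)
    (hv : ContDiffAt ℝ n v x) (hw : ContDiffAt ℝ n w x)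
    (h1 : 0 < d1 B (u x)) (h2 : 0 < d2 B (u x) (v x)) :
    ContDiffAt ℝ n (fun y => momentumOneDot B α (u y) (v y) (w y)) x := by
  unfold momentumOneDot
  rw [d1_eq_bf] at h1
  have hR := (Real.sqrt_pos.2 h2).ne'
  have hD := contDiffAt_d2 hB hu hv
  have hs := hD.sqrt h2.ne'
  have ha := hu.bf B hu
  have hc := (hu.bf B hv).div ha h1.ne'
  exact ((((contDiffAt_const.mul ((ha.mul (hv.bf B hw)).sub
      ((hu.bf B hv).mul (hu.bf B hw)))).div (hD.mul hs) (mul_ne_zero h2.ne' hR)).neg).smul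
      (hv.sub (hc.smul hu))).add
    ((contDiffAt_const.div hs hR).smul (hw.sub ((hc.smul hv).add
      ((((((hv.bf B hv).add (hu.bf B hw)).mul ha).sub
        (contDiffAt_const.mul ((hu.bf B hv).pow 2))).div (ha.pow 2)
          (pow_ne_zero 2 h1.ne')).smul hu))))

end Smooth

theorem hasDerivAt_d2_line (hB : B.IsSymm) (x1 x2 w1 w2 : V d) :
    HasDerivAt (fun t : ℝ => d2 B (x1 + t • w1) (x2 + t • w2))
      (2 * (bf B x1 w1 * bf B x2 x2 + bf B x1 x1 * bf B x2 w2 -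
        bf B x1 x2 * (bf B x2 w1 + bf B x1 w2))) 0 := by
  simp only [d2_eq_bf hB]
  have hu := hasDerivAt_add_smul x1 w1
  have hv := hasDerivAt_add_smul x2 w2
  refine (((hu.bf B hu).mul (hv.bf B hv)).sub ((hu.bf B hv).pow 2)).congr_deriv ?_
  simp only [zero_smul, add_zero, bf_comm hB w1, bf_comm hB w2]
  ring

theorem fderiv_Lc_apply (hB : B.IsSymm) (h1 : 0 < d1 B x1) (h2 : 0 < d2 B x1 x2)
    (w0 w1 w2 : V d) :
    fderiv ℝ (Lc B α) (x0, x1, x2) (w0, w1, w2) =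
      bf B (gradOne B α x1 x2) w1 + bf B (momentumOne B α x1 x2) w2 := by
  apply fderiv_apply_eq_of_hasDerivAt_line
    ((contDiffAt_Lc (n := 1) hB h1 h2).differentiableAt one_ne_zero)
  have hu := hasDerivAt_add_smul x1 w1
  have hR := Real.sqrt_pos.2 h2
  rw [d1_eq_bf] at h1
  have h := (((hasDerivAt_d2_line hB x1 x2 w1 w2).sqrt (by simpa using h2.ne')).const_mul α).div
    (hu.bf B hu) (by simpa using h1.ne')
  simp only [Lc, d1_eq_bf, Prod.smul_mk, Prod.mk_add_mk]
  refine h.congr_deriv ?_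
  simp only [zero_smul, add_zero, gradOne, momentumOne, bf_add_left, bf_sub_left, bf_smul_left,
    bf_comm hB w1]
  field_simp
  ring

theorem p1h_eq_momentumOne (hB : B.IsSymm) (hBnd : IsUnit B.det) (h1 : 0 < d1 B x1)
    (h2 : 0 < d2 B x1 x2) : p1h B α x0 x1 x2 = momentumOne B α x1 x2 := by
  have h0 : ∀ u : V d, bf B u 0 = 0 := fun u => by simp [bf]
  simp only [p1h, fderiv_Lc_apply hB h1 h2, h0, zero_add, inv_mulVec_bf_single hB hBnd]

theorem hasDerivAt_momentumOne_line (hB : B.IsSymm) (h1 : 0 < d1 B x1) (h2 : 0 < d2 B x1 x2) :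
    HasDerivAt (fun t : ℝ => momentumOne B α (x1 + t • x2) (x2 + t • x3))
      (momentumOneDot B α x1 x2 x3) 0 := by
  have hu := hasDerivAt_add_smul x1 x2
  have hv := hasDerivAt_add_smul x2 x3
  have hR := Real.sqrt_pos.2 h2
  have hRR := Real.sq_sqrt h2.le
  rw [d1_eq_bf] at h1
  have h := ((((hasDerivAt_d2_line hB x1 x2 x2 x3).sqrt (by simpa using h2.ne')).fun_inv
    (by simpa using hR.ne')).const_mul α).fun_smul
    (hv.fun_sub (((hu.bf B hv).fun_div (hu.bf B hu) (by simpa using h1.ne')).fun_smul hu))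
  simp only [momentumOne, momentumOneDot, div_eq_mul_inv α]
  refine h.congr_deriv ?_
  simp only [zero_smul, add_zero, bf_comm hB x2 x1]
  rw [add_comm]
  congr 2
  · rw [hRR]
    field_simp
    ring
  · rw [mul_add, ← sq, ← two_mul]

theorem eventually_pos {E : Type*} [TopologicalSpace E] {u v : E → V d} {x : E} (hB : B.IsSymm)
    (hu : ContinuousAt u x) (hv : ContinuousAt v x)
    (h1 : 0 < d1 B (u x)) (h2 : 0 < d2 B (u x) (v x)) :
    ∀ᶠ y in nhds x, 0 < d1 B (u y) ∧ 0 < d2 B (u y) (v y) := by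
  have hc1 : Continuous fun z : V d × V d => d1 B z.1 := by
    simp only [d1_eq_bf, bf, dotProduct, Matrix.mulVec]
    fun_prop
  have hc2 : Continuous fun z : V d × V d => d2 B z.1 z.2 := by
    simp only [d2_eq_bf hB, bf, dotProduct, Matrix.mulVec]
    fun_prop
  have hopen : IsOpen {z : V d × V d | 0 < d1 B z.1 ∧ 0 < d2 B z.1 z.2} :=
    (isOpen_lt continuous_const hc1).inter (isOpen_lt continuous_const hc2)
  exact (hu.prodMk hv).preimage_mem_nhds (hopen.mem_nhds ⟨h1, h2⟩)

theorem p0h_eq_gradOne_sub (hB : B.IsSymm) (hBnd : IsUnit B.det) (h1 : 0 < d1 B x1)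
    (h2 : 0 < d2 B x1 x2) :
    p0h B α x0 x1 x2 x3 = gradOne B α x1 x2 - momentumOneDot B α x1 x2 x3 := by
  have h0 : ∀ u : V d, bf B u 0 = 0 := fun u => by simp [bf]
  have hu : ContDiffAt ℝ 1 (fun y : V d × V d × V d => y.2.1) (x0, x1, x2) := by fun_prop
  have hv : ContDiffAt ℝ 1 (fun y : V d × V d × V d => y.2.2) (x0, x1, x2) := by fun_prop
  have hP : DifferentiableAt ℝ (fun y : V d × V d × V d => momentumOne B α y.2.1 y.2.2)
      (x0, x1, x2) :=
    (contDiffAt_momentumOne hB hu hv h1 h2).differentiableAt one_ne_zero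
  have hP' : fderiv ℝ (fun y : V d × V d × V d => momentumOne B α y.2.1 y.2.2)
      (x0, x1, x2) (x1, x2, x3) = momentumOneDot B α x1 x2 x3 := by
    apply fderiv_apply_eq_of_hasDerivAt_line hP
    simpa only [Prod.smul_mk, Prod.mk_add_mk] using hasDerivAt_momentumOne_line hB h1 h2
  have hD : ∀ a, fderiv ℝ (fun y : V d × V d × V d =>
      bf B (p1h B α y.1 y.2.1 y.2.2) (Pi.single a 1)) (x0, x1, x2) (x1, x2, x3) =
      bf B (momentumOneDot B α x1 x2 x3) (Pi.single a 1) := by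
    intro a
    have he : (fun y : V d × V d × V d => bf B (p1h B α y.1 y.2.1 y.2.2) (Pi.single a 1))
        =ᶠ[nhds (x0, x1, x2)]
        fun y => bf B (momentumOne B α y.2.1 y.2.2) (Pi.single a 1) := by
      filter_upwards [eventually_pos hB hu.continuousAt hv.continuousAt h1 h2] with y hy
      rw [p1h_eq_momentumOne hB hBnd hy.1 hy.2]
    rw [he.fderiv_eq, fderiv_bf_apply B hP (differentiableAt_const _), hP']
    simp [h0]
  simp only [p0h, fderiv_Lc_apply hB h1 h2, hD, h0, add_zero, ← bf_sub_left,
    inv_mulVec_bf_single hB hBnd]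

theorem bf_p0h_left (hB : B.IsSymm) (hBnd : IsUnit B.det) (h1 : 0 < d1 B x1)
    (h2 : 0 < d2 B x1 x2) : bf B (p0h B α x0 x1 x2 x3) x1 = 0 := by
  have hR := Real.sqrt_pos.2 h2
  have hRR := Real.sq_sqrt h2.le
  have hD := d2_eq_bf hB x1 x2
  rw [p0h_eq_gradOne_sub hB hBnd h1 h2]
  rw [d1_eq_bf] at h1
  have hb : bf B x2 x2 = (√(d2 B x1 x2) ^ 2 + bf B x1 x2 ^ 2) / bf B x1 x1 := by
    field_simp
    linarith
  simp only [gradOne, momentumOneDot, bf_sub_left, bf_add_left, bf_smul_left,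
    bf_comm hB x2 x1, bf_comm hB x3 x1]
  generalize √(d2 B x1 x2) = R at *
  rw [hb, ← hRR]
  field_simp
  ring

theorem bf_p0h_right (hB : B.IsSymm) (hBnd : IsUnit B.det) (h1 : 0 < d1 B x1)
    (h2 : 0 < d2 B x1 x2) : bf B (p0h B α x0 x1 x2 x3) x2 = 0 := by
  have hR := Real.sqrt_pos.2 h2
  have hRR := Real.sq_sqrt h2.le
  have hD := d2_eq_bf hB x1 x2
  rw [p0h_eq_gradOne_sub hB hBnd h1 h2]
  rw [d1_eq_bf] at h1
  have hb : bf B x2 x2 = (√(d2 B x1 x2) ^ 2 + bf B x1 x2 ^ 2) / bf B x1 x1 := by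
    field_simp
    linarith
  simp only [gradOne, momentumOneDot, bf_sub_left, bf_add_left, bf_smul_left,
    bf_comm hB x3 x2]
  generalize √(d2 B x1 x2) = R at *
  rw [hb, ← hRR]
  field_simp
  ring

end Momenta

/-- Along the total derivative, `(ṗ⁰ p̂¹) = (p̂⁰ p̂⁰)`, because `p̂⁰` is orthogonal to
`x₁` and `x₂`. -/
theorem bf_fderiv_p0h_p1h {B : Matrix (Fin d) (Fin d) ℝ} {α : ℝ} {x0 x1 x2 x3 x4 : V d}
    (hB : B.IsSymm) (hBnd : IsUnit B.det) (h1 : 0 < d1 B x1) (h2 : 0 < d2 B x1 x2)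
    (hf : DifferentiableAt ℝ (fun y : V d × V d × V d × V d =>
      p0h B α y.1 y.2.1 y.2.2.1 y.2.2.2) (x0, x1, x2, x3)) :
    bf B (fderiv ℝ (fun y : V d × V d × V d × V d => p0h B α y.1 y.2.1 y.2.2.1 y.2.2.2)
        (x0, x1, x2, x3) (x1, x2, x3, x4)) (p1h B α x0 x1 x2) =
      bf B (p0h B α x0 x1 x2 x3) (p0h B α x0 x1 x2 x3) := by
  have horth : ∀ {y0 y1 y2 y3 : V d}, 0 < d1 B y1 → 0 < d2 B y1 y2 →
      bf B (p0h B α y0 y1 y2 y3) (momentumOne B α y1 y2) = 0 := by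
    intro y0 y1 y2 y3 k1 k2
    rw [bf_comm hB, momentumOne, bf_smul_left, bf_sub_left, bf_smul_left, bf_comm hB y2,
      bf_comm hB y1 (p0h _ _ _ _ _ _), bf_p0h_left hB hBnd k1 k2, bf_p0h_right hB hBnd k1 k2]
    ring
  have hu : ContDiffAt ℝ 1 (fun y : V d × V d × V d × V d => y.2.1) (x0, x1, x2, x3) := by
    fun_prop
  have hv : ContDiffAt ℝ 1 (fun y : V d × V d × V d × V d => y.2.2.1) (x0, x1, x2, x3) := by
    fun_prop
  have hg : DifferentiableAt ℝ (fun y : V d × V d × V d × V d =>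
      momentumOne B α y.2.1 y.2.2.1) (x0, x1, x2, x3) :=
    (contDiffAt_momentumOne hB hu hv h1 h2).differentiableAt one_ne_zero
  have hg' : fderiv ℝ (fun y : V d × V d × V d × V d => momentumOne B α y.2.1 y.2.2.1)
      (x0, x1, x2, x3) (x1, x2, x3, x4) = momentumOneDot B α x1 x2 x3 := by
    apply fderiv_apply_eq_of_hasDerivAt_line hg
    simpa only [Prod.smul_mk, Prod.mk_add_mk] using hasDerivAt_momentumOne_line hB h1 h2
  have hzero : (fun y : V d × V d × V d × V d =>
      bf B (p0h B α y.1 y.2.1 y.2.2.1 y.2.2.2) (momentumOne B α y.2.1 y.2.2.1))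
      =ᶠ[nhds (x0, x1, x2, x3)] fun _ => 0 := by
    filter_upwards [eventually_pos hB hu.continuousAt hv.continuousAt h1 h2] with y hy
    exact horth hy.1 hy.2
  have hprod := fderiv_bf_apply B hf hg (x1, x2, x3, x4)
  rw [hzero.fderiv_eq, hg'] at hprod
  have hgrad : bf B (p0h B α x0 x1 x2 x3) (gradOne B α x1 x2) = 0 := by
    rw [gradOne, bf_add_right, bf_smul_right, bf_smul_right, bf_p0h_left hB hBnd h1 h2,
      bf_p0h_right hB hBnd h1 h2]
    ring
  have hdot : momentumOneDot B α x1 x2 x3 =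
      gradOne B α x1 x2 + (-1 : ℝ) • p0h B α x0 x1 x2 x3 := by
    rw [p0h_eq_gradOne_sub hB hBnd h1 h2]
    module
  rw [p1h_eq_momentumOne hB hBnd h1 h2]
  rw [hdot, bf_add_right, bf_smul_right, hgrad] at hprod
  simp at hprod
  linarith

theorem differentiableAt_p0h {B : Matrix (Fin d) (Fin d) ℝ} {α : ℝ} {x0 x1 x2 x3 : V d}
    (hB : B.IsSymm) (hBnd : IsUnit B.det) (h1 : 0 < d1 B x1) (h2 : 0 < d2 B x1 x2) :
    DifferentiableAt ℝ (fun y : V d × V d × V d × V d => p0h B α y.1 y.2.1 y.2.2.1 y.2.2.2)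
      (x0, x1, x2, x3) := by
  have hu : ContDiffAt ℝ 1 (fun y : V d × V d × V d × V d => y.2.1) (x0, x1, x2, x3) := by
    fun_prop
  have hv : ContDiffAt ℝ 1 (fun y : V d × V d × V d × V d => y.2.2.1) (x0, x1, x2, x3) := by
    fun_prop
  have hw : ContDiffAt ℝ 1 (fun y : V d × V d × V d × V d => y.2.2.2) (x0, x1, x2, x3) := by
    fun_prop
  have hd : DifferentiableAt ℝ (fun y : V d × V d × V d × V d =>
      gradOne B α y.2.1 y.2.2.1 - momentumOneDot B α y.2.1 y.2.2.1 y.2.2.2) (x0, x1, x2, x3) :=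
    ((contDiffAt_gradOne hB hu hv h1 h2).sub
      (contDiffAt_momentumOneDot hB hu hv hw h1 h2)).differentiableAt one_ne_zero
  apply hd.congr_of_eventuallyEq
  filter_upwards [eventually_pos hB hu.continuousAt hv.continuousAt h1 h2] with y hy
  exact p0h_eq_gradOne_sub hB hBnd hy.1 hy.2

/-- the second lagrangian gauge transformation.
For the curvature Lagrangian and every smooth `ε : ℝ → ℝ`, the transformation
`δx = 2ε(t) p̂⁰ + ε′(t) p̂¹` is a Noether gauge transformation with conserved
quantity `G_L = ε(t)(p̂⁰ p̂⁰)`: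
`⟨[L], 2ε(t)p̂⁰ + ε′(t)p̂¹⟩ + D_t(ε(t)(p̂⁰ p̂⁰)) = 0` identically where
`δ₁ > 0` and `δ₂ > 0`. -/
theorem curvature_second_gauge_transformation
    (d : ℕ) (hd : 3 ≤ d) (B : Matrix (Fin d) (Fin d) ℝ)
    (hBsymm : B.IsSymm) (hBnd : IsUnit B.det)
    (α : ℝ) (hα : α ≠ 0)
    (ε : ℝ → ℝ) (hε : ContDiff ℝ (⊤ : ℕ∞) ε) :
    ∀ (t : ℝ) (x0 x1 x2 x3 x4 : V d), 0 < d1 B x1 → 0 < d2 B x1 x2 →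
      ELc B α x0 x1 x2 x3 x4
          ((2 * ε t) • p0h B α x0 x1 x2 x3 + deriv ε t • p1h B α x0 x1 x2) +
        DtT (fun z : ℝ × (V d × V d × V d × V d) =>
            ε z.1 * bf B (p0h B α z.2.1 z.2.2.1 z.2.2.2.1 z.2.2.2.2)
                         (p0h B α z.2.1 z.2.2.1 z.2.2.2.1 z.2.2.2.2))
          t x0 x1 x2 x3 x4 = 0 := by
  intro t x0 x1 x2 x3 x4 h1 h2
  have hf : DifferentiableAt ℝ (fun y : V d × V d × V d × V d =>
      p0h B α y.1 y.2.1 y.2.2.1 y.2.2.2) (x0, x1, x2, x3) :=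
    differentiableAt_p0h hBsymm hBnd h1 h2
  have hkey := bf_fderiv_p0h_p1h (x4 := x4) hBsymm hBnd h1 h2 hf
  have h0 : ∀ u : V d, bf B u 0 = 0 := fun u => by simp [bf]
  set p0 := p0h B α x0 x1 x2 x3 with hp0
  set D := fderiv ℝ (fun y : V d × V d × V d × V d => p0h B α y.1 y.2.1 y.2.2.1 y.2.2.2)
    (x0, x1, x2, x3) (x1, x2, x3, x4) with hD
  have hEL : ∀ v : V d, ELc B α x0 x1 x2 x3 x4 v = -bf B D v := by
    intro v
    rw [ELc, fderiv_Lc_apply hBsymm h1 h2, fderiv_bf_apply B hf (differentiableAt_const v)]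
    simp [h0, hD]
  have hnorm : DifferentiableAt ℝ (fun y : V d × V d × V d × V d =>
      bf B (p0h B α y.1 y.2.1 y.2.2.1 y.2.2.2) (p0h B α y.1 y.2.1 y.2.2.1 y.2.2.2))
      (x0, x1, x2, x3) := differentiableAt_bf B hf hf
  have hε' : DifferentiableAt ℝ ε t := (hε.differentiable (by simp)).differentiableAt
  have hDt : DtT (fun z : ℝ × (V d × V d × V d × V d) =>
      ε z.1 * bf B (p0h B α z.2.1 z.2.2.1 z.2.2.2.1 z.2.2.2.2)
        (p0h B α z.2.1 z.2.2.1 z.2.2.2.1 z.2.2.2.2)) t x0 x1 x2 x3 x4 =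
      deriv ε t * bf B p0 p0 + ε t * (2 * bf B D p0) := by
    have he := hε'.hasFDerivAt.comp (t, (x0, x1, x2, x3))
      (hasFDerivAt_fst (𝕜 := ℝ) (p := (t, (x0, x1, x2, x3))))
    have hn := hnorm.hasFDerivAt.comp (t, (x0, x1, x2, x3))
      (hasFDerivAt_snd (𝕜 := ℝ) (p := (t, (x0, x1, x2, x3))))
    have := (he.mul hn).fderiv
    rw [DtT]
    refine (congrArg (fun l => l (1, (x1, x2, x3, x4))) this).trans ?_
    simp [fderiv_bf_apply B hf hf, ← hD, ← hp0, bf_comm hBsymm p0 D]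
    ring
  rw [hEL, hDt, bf_add_right, bf_smul_right, bf_smul_right, hkey]
  ring

end
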